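/- arXiv:1905.07028 — 2 statements merged into one kernel-verified Lean document; each statement's English description precedes it below -/
import Mathlib

section
/- Let h be a history from (q₀,s₀) ending at combined state c, h_loop a history from c of positive length ending at c with ℓ(h_loop) < 1, and h_goal a goal history from c. Then the total likelihood of the family of goal histories {h·h_loop^m·h_goal : m ≥ 0} equals Σ_{m≥0} ℓ(h)·(ℓ(h_loop))^m·ℓ(h_goal) = ℓ(h)·ℓ(h_goal) / (1 − ℓ(h_loop)). -/
open scoped ENNReal

/-- An environment: a stochastic transition function (a probability mass function
on next states for each state/action pair) and an observation function. -/
structure Env (S A O : Type) where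
  tr : S → A → PMF S
  obs : S → O

/-- A finite-state controller. `gam q o = some (some a)` means the labeling function
is defined and yields action `a`; `some none` means it yields `stop`; `none` means
it is undefined.  `del` is the (partial) controller transition function. -/
structure FSC (Q O A : Type) where
  q0 : Q
  gam : Q → O → Option (Option A)
  del : Q → O → Option Q

variable {S A O Q : Type}

/-- One-step transition weight of the combined system.  It is nonzero exactly when
the labeling function is defined and yields a proper action (not `stop`), the
controller transition is defined and matches the next controller state, and the
environment transition has positive probability; in that case it equals
`Δ(s' | s, a)`. -/
noncomputable def stepP (E : Env S A O) (C : FSC Q O A) (c c' : Q × S) : ℝ≥0∞ :=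
  match C.gam c.1 (E.obs c.2) with
  | some (some a) =>
      haveI := Classical.propDecidable (C.del c.1 (E.obs c.2) = some c'.1)
      if C.del c.1 (E.obs c.2) = some c'.1 then E.tr c.2 a c'.2 else 0
  | _ => 0

/-- `h` is a history of the system `⟨E, C⟩` from combined state `c`.
(A history of length `T` is a list with `T + 1` elements.) -/
def IsHistory (E : Env S A O) (C : FSC Q O A) (c : Q × S) (h : List (Q × S)) : Prop :=
  h.head? = some c ∧
  ∀ t (ht : t + 1 < h.length), 0 < stepP E C (h[t]'(by omega)) (h[t + 1]'ht)

/-- The likelihood of a history. -/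
noncomputable def lh (E : Env S A O) (C : FSC Q O A) : List (Q × S) → ℝ≥0∞
  | [] => 1
  | [_] => 1
  | c :: c' :: rest => stepP E C c c' * lh E C (c' :: rest)

/-- A history is terminating if the action at its last combined state is `stop`. -/
def IsTerminating (E : Env S A O) (C : FSC Q O A) (h : List (Q × S)) : Prop :=
  ∃ c, h.getLast? = some c ∧ C.gam c.1 (E.obs c.2) = some none

/-- A goal history: terminating, with final environment state in the goal set `G`. -/
def IsGoal (E : Env S A O) (C : FSC Q O A) (G : Set S) (h : List (Q × S)) : Prop :=
  ∃ c, h.getLast? = some c ∧ C.gam c.1 (E.obs c.2) = some none ∧ c.2 ∈ G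

/-- Concatenation of compatible histories: `h₁` followed by `h₂` with its first
element removed. -/
def hcat (h₁ h₂ : List (Q × S)) : List (Q × S) := h₁ ++ h₂.tail

/-- Total likelihood of termination. -/
noncomputable def LTER (E : Env S A O) (C : FSC Q O A) (c0 : Q × S) : ℝ≥0∞ :=
  ∑' h : {h : List (Q × S) // IsHistory E C c0 h ∧ IsTerminating E C h}, lh E C h.1

/-- Total likelihood of goal termination. -/
noncomputable def LGT (E : Env S A O) (C : FSC Q O A) (G : Set S) (c0 : Q × S) : ℝ≥0∞ :=
  ∑' h : {h : List (Q × S) // IsHistory E C c0 h ∧ IsGoal E C G h}, lh E C h.1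

/-- `m`-fold concatenation of a loop history `hl` from `c` back to `c`
(`hpow c hl 0` is the trivial history `[c]`). -/
def hpow {S Q : Type} (c : Q × S) (hl : List (Q × S)) : ℕ → List (Q × S)
  | 0 => [c]
  | m + 1 => hcat hl (hpow c hl m)

theorem lh_hcat (E : Env S A O) (C : FSC Q O A) {c : Q × S} {h₁ h₂ : List (Q × S)}
    (hlast : h₁.getLast? = some c) (hhead : h₂.head? = some c) :
    lh E C (hcat h₁ h₂) = lh E C h₁ * lh E C h₂ := by
  obtain ⟨t, rfl⟩ : ∃ t, h₂ = c :: t := List.head?_eq_some_iff.mp hhead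
  induction h₁ with
  | nil => simp at hlast
  | cons a l ih =>
    cases l with
    | nil =>
      obtain rfl : a = c := by simpa using hlast
      simp [hcat, lh]
    | cons b l =>
      have := ih (by simpa [List.getLast?_cons_cons] using hlast)
      simp only [hcat, List.tail_cons, List.cons_append, lh] at this ⊢
      rw [this, mul_assoc]

theorem getLast?_hcat {c d : Q × S} {h₁ h₂ : List (Q × S)}
    (hlast : h₁.getLast? = some c) (hhead : h₂.head? = some c)
    (hlast' : h₂.getLast? = some d) : (hcat h₁ h₂).getLast? = some d := by
  obtain ⟨t, rfl⟩ : ∃ t, h₂ = c :: t := List.head?_eq_some_iff.mp hhead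
  cases t with
  | nil => simp_all [hcat]
  | cons b t => simp_all [hcat, List.getLast?_append, List.getLast?_cons_cons]

theorem head?_hcat {c : Q × S} {h₁ h₂ : List (Q × S)} (hhead : h₁.head? = some c) :
    (hcat h₁ h₂).head? = some c := by
  simp [hcat, hhead]

theorem head?_hpow {c : Q × S} {hl : List (Q × S)} (hhead : hl.head? = some c) (m : ℕ) :
    (hpow c hl m).head? = some c := by
  cases m with
  | zero => rfl
  | succ m => exact head?_hcat hhead

theorem getLast?_hpow {c : Q × S} {hl : List (Q × S)} (hhead : hl.head? = some c)
    (hlast : hl.getLast? = some c) (m : ℕ) : (hpow c hl m).getLast? = some c := by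
  induction m with
  | zero => rfl
  | succ m ih => exact getLast?_hcat hlast (head?_hpow hhead m) ih

theorem lh_hpow (E : Env S A O) (C : FSC Q O A) {c : Q × S} {hl : List (Q × S)}
    (hhead : hl.head? = some c) (hlast : hl.getLast? = some c) (m : ℕ) :
    lh E C (hpow c hl m) = lh E C hl ^ m := by
  induction m with
  | zero => simp [hpow, lh]
  | succ m ih => rw [hpow, lh_hcat E C hlast (head?_hpow hhead m), ih, pow_succ']

/-- the total likelihood of the family of goal histories
`{h·h_loop^m·h_goal : m ≥ 0}` is the geometric sum
`Σ_m ℓ(h)·ℓ(h_loop)^m·ℓ(h_goal) = ℓ(h)·ℓ(h_goal)/(1 − ℓ(h_loop))`. -/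
theorem loop_pump_total_likelihood
    {S A O Q : Type} [Fintype S] [Nonempty S] [Fintype A] [Nonempty A]
    [Fintype O] [Nonempty O] [Fintype Q] [Nonempty Q]
    (E : Env S A O) (C : FSC Q O A) (G : Set S)
    (q₀ : Q) (s₀ : S) (c : Q × S) (h hloop hgoal : List (Q × S))
    (hh : IsHistory E C (q₀, s₀) h) (hend : h.getLast? = some c)
    (hhl : IsHistory E C c hloop) (hlpos : 2 ≤ hloop.length)
    (hlend : hloop.getLast? = some c) (hllt : lh E C hloop < 1)
    (hhg : IsHistory E C c hgoal) (hg : IsGoal E C G hgoal) :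
    (∑' m : ℕ, lh E C (hcat (hcat h (hpow c hloop m)) hgoal))
        = ∑' m : ℕ, lh E C h * (lh E C hloop) ^ m * lh E C hgoal ∧
    (∑' m : ℕ, lh E C (hcat (hcat h (hpow c hloop m)) hgoal))
        = lh E C h * lh E C hgoal / (1 - lh E C hloop) := by
  have hterm (m : ℕ) : lh E C (hcat (hcat h (hpow c hloop m)) hgoal) =
      lh E C h * lh E C hloop ^ m * lh E C hgoal := by
    have hhead := head?_hpow hhl.1 m
    rw [lh_hcat E C (getLast?_hcat hend hhead (getLast?_hpow hhl.1 hlend m)) hhg.1,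
      lh_hcat E C hend hhead, lh_hpow E C hhl.1 hlend]
  simp_rw [hterm]
  refine ⟨trivial, ?_⟩
  rw [ENNReal.tsum_mul_right, ENNReal.tsum_mul_left, ENNReal.tsum_geometric, div_eq_mul_inv,
    mul_right_comm]
end

section
/- (Unique loop decomposition, Lemma 1.) Fix a history h = h^(0:n) from (q₀,s₀) whose combined states are pairwise distinct, and fix k with 1 ≤ k ≤ n. Let h* be any goal history with h*^(0) = h^(k−1) such that no element of h* at positions ≥ 1 equals h^(k−1) and no element of h* equals h^(i) for any i < k−1. Then exactly one of the following holds: (i) h*^(1) ≠ h^(k) (i.e., h* ∈ H_goal^k); or (ii) there exist a unique m ≥ 0, unique h_{l,1},…,h_{l,m} ∈ H_loop^k, and a unique goal history h_g from h^(k) no element of which at positions ≥ 1 equals h^(i) for any i ≤ k, such that h* = h^(k−1:k) · h_{l,1} · … · h_{l,m} · h_g. -/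
open scoped ENNReal

variable {S A O Q : Type}

/-- Membership in `H_loop^k` (with `ck = h^(k)` and `avoid = {h^(i) : i < k}`):
a history of positive length from `ck` back to `ck` containing `ck` only as its
first and last element, and avoiding `avoid`. -/
def HLoopP {S A O Q : Type} (E : Env S A O) (C : FSC Q O A) (ck : Q × S)
    (avoid : List (Q × S)) (hl : List (Q × S)) : Prop :=
  IsHistory E C ck hl ∧ 2 ≤ hl.length ∧ hl.getLast? = some ck ∧
  ck ∉ hl.tail.dropLast ∧ ∀ x ∈ avoid, x ∉ hl

/-- Membership in `H_goal^k` (with `c = h^(k−1)`, `avoid = {h^(i) : i < k−1}`,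
`nextNe = h^(k)`): a goal history from `c` containing `c` only at position `0`,
avoiding `avoid`, and whose element at position `1` (if any) differs from
`nextNe`. -/
def HGoalP {S A O Q : Type} (E : Env S A O) (C : FSC Q O A) (G : Set S)
    (c : Q × S) (avoid : List (Q × S)) (nextNe : Q × S)
    (hg : List (Q × S)) : Prop :=
  IsHistory E C c hg ∧ IsGoal E C G hg ∧ c ∉ hg.tail ∧
  (∀ x ∈ avoid, x ∉ hg) ∧ ∀ x, hg.tail.head? = some x → x ≠ nextNe

/-- Concatenation of a history with a list of compatible continuation histories. -/
def hcatAll {S Q : Type} (base : List (Q × S)) :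
    List (List (Q × S)) → List (Q × S)
  | [] => base
  | l :: ls => hcatAll (hcat base l) ls

theorem isHistory_iff_isChain (E : Env S A O) (C : FSC Q O A) (c : Q × S) (h : List (Q × S)) :
    IsHistory E C c h ↔ h.head? = some c ∧ h.IsChain (fun x y => 0 < stepP E C x y) := by
  rw [IsHistory, List.isChain_iff_getElem]

theorem hcatAll_eq_append_flatMap (base : List (Q × S)) (ls : List (List (Q × S))) :
    hcatAll base ls = base ++ ls.flatMap List.tail := by
  induction ls generalizing base with
  | nil => simp [hcatAll]
  | cons l ls ih => simp [hcatAll, hcat, ih]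

/-- A list starting and ending with `a`, of length at least two, with no other occurrence of `a`. -/
def IsLoopAt {α : Type*} (a : α) (l : List α) : Prop :=
  ∃ w, l = a :: (w ++ [a]) ∧ a ∉ w

theorem HLoopP.isLoopAt {E : Env S A O} {C : FSC Q O A} {c : Q × S} {avoid l : List (Q × S)}
    (hl : HLoopP E C c avoid l) : IsLoopAt c l := by
  obtain ⟨⟨hhead, -⟩, hlen, hlast, hmem, -⟩ := hl
  obtain ⟨tl, rfl⟩ := List.head?_eq_some_iff.mp hhead
  rcases List.eq_nil_or_concat tl with rfl | ⟨w, b, rfl⟩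
  · simp at hlen
  · simp [List.getLast?_cons] at hlast hmem
    exact ⟨w, by simp [hlast], hmem⟩

/-- A walk from `a` splits into loops at `a` followed by a final segment avoiding `a`. -/
theorem exists_loop_decomposition {α : Type*} (R : α → α → Prop) (a : α) (r : List α)
    (hr : (a :: r).IsChain R) :
    ∃ (ls : List (List α)) (t : List α), (∀ l ∈ ls, IsLoopAt a l ∧ l.IsChain R ∧ l ⊆ a :: r) ∧
      a ∉ t ∧ (a :: t).IsChain R ∧ t ⊆ r ∧ r = ls.flatMap List.tail ++ t ∧
      (a :: r).getLast? = (a :: t).getLast? := by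
  by_cases ha : a ∈ r
  · obtain ⟨w, r', rfl, hw⟩ := List.eq_append_cons_of_mem ha
    have hsplit : a :: (w ++ a :: r') = (a :: w) ++ a :: r' := rfl
    rw [hsplit, List.isChain_split] at hr
    obtain ⟨ls, t, hls, hat, ht, hsub, heq, hlast⟩ := exists_loop_decomposition R a r' hr.2
    refine ⟨(a :: (w ++ [a])) :: ls, t, ?_, hat, ht, ?_, ?_, ?_⟩
    · intro l hl
      rcases List.mem_cons.mp hl with rfl | hl
      · exact ⟨⟨w, rfl, hw⟩, by simpa using hr.1, by intro x; simp; tauto⟩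
      · obtain ⟨h₁, h₂, h₃⟩ := hls l hl
        refine ⟨h₁, h₂, fun x hx => ?_⟩
        have := h₃ hx
        simp at this ⊢
        tauto
    · intro x hx
      simp [hsub hx]
    · simp [← heq]
    · rw [← hlast, hsplit, List.getLast?_append]
      rfl
  · exact ⟨[], r, by simp, ha, hr, fun _ => id, by simp, rfl⟩
termination_by r.length
decreasing_by subst_vars; simp; omega

theorem loop_decomposition_unique {α : Type*} {a : α} {ls ls' : List (List α)} {t t' : List α}
    (hls : ∀ l ∈ ls, IsLoopAt a l) (hls' : ∀ l ∈ ls', IsLoopAt a l) (ht : a ∉ t) (ht' : a ∉ t')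
    (heq : ls.flatMap List.tail ++ t = ls'.flatMap List.tail ++ t') : ls = ls' ∧ t = t' := by
  induction ls generalizing ls' with
  | nil =>
    cases ls' with
    | nil => simpa using heq
    | cons l' ls' =>
      obtain ⟨w', rfl, -⟩ := hls' l' (by simp)
      simp at heq
      simp [heq] at ht
  | cons l ls ih =>
    obtain ⟨w, rfl, hw⟩ := hls l (by simp)
    cases ls' with
    | nil =>
      simp at heq
      simp [← heq] at ht'
    | cons l' ls' =>
      obtain ⟨w', rfl, hw'⟩ := hls' l' (by simp)
      simp only [List.flatMap_cons, List.tail_cons, List.append_assoc, List.singleton_append] at heq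
      have key : w = w' ∧ ls.flatMap List.tail ++ t = ls'.flatMap List.tail ++ t' := by
        rcases List.append_eq_append_iff.mp heq with ⟨u, hu, hv⟩ | ⟨u, hu, hv⟩ <;>
          cases u <;> simp_all
      obtain ⟨rfl, hrest⟩ := key
      obtain ⟨rfl, rfl⟩ := ih (fun l hl => hls l (by simp [hl])) (fun l hl => hls' l (by simp [hl]))
        hrest
      exact ⟨rfl, rfl⟩

/-- unique loop decomposition, Lemma 1: any goal history `h*`
from `h^(k−1)` not revisiting `h^(k−1)` (at positions `≥ 1`) nor any `h^(i)`
with `i < k−1` either lies in `H_goal^k`, or decomposes uniquely as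
`h^(k−1:k) · h_{l,1} · … · h_{l,m} · h_g` with the `h_{l,i} ∈ H_loop^k` and
`h_g` a goal history from `h^(k)` not revisiting any `h^(i)`, `i ≤ k`, at
positions `≥ 1` — but not both. -/
theorem unique_loop_decomposition
    {S A O Q : Type} [Fintype S] [Nonempty S] [Fintype A] [Nonempty A]
    [Fintype O] [Nonempty O] [Fintype Q] [Nonempty Q]
    (E : Env S A O) (C : FSC Q O A) (G : Set S) (q₀ : Q) (s₀ : S)
    (h : List (Q × S)) (n k : ℕ)
    (hh : IsHistory E C (q₀, s₀) h) (hlen : h.length = n + 1)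
    (hnd : h.Nodup) (hk1 : 1 ≤ k) (hk2 : k ≤ n)
    (hstar : List (Q × S))
    (hsh : IsHistory E C (h[k - 1]'(by omega)) hstar)
    (hsg : IsGoal E C G hstar)
    (hs1 : (h[k - 1]'(by omega)) ∉ hstar.tail)
    (hs2 : ∀ x ∈ h.take (k - 1), x ∉ hstar) :
    Xor'
      (HGoalP E C G (h[k - 1]'(by omega)) (h.take (k - 1)) (h[k]'(by omega)) hstar)
      (∃! p : List (List (Q × S)) × List (Q × S),
        (∀ l ∈ p.1, HLoopP E C (h[k]'(by omega)) (h.take k) l) ∧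
        IsHistory E C (h[k]'(by omega)) p.2 ∧ IsGoal E C G p.2 ∧
        (∀ x ∈ h.take (k + 1), x ∉ p.2.tail) ∧
        hstar = hcat (hcatAll [h[k - 1]'(by omega), h[k]'(by omega)] p.1) p.2) := by
  have hck : h.take k = h.take (k - 1) ++ [h[k - 1]'(by omega)] := by
    conv_lhs => rw [show k = k - 1 + 1 by omega]
    rw [List.take_succ_eq_append_getElem (by omega)]
  have hck' : h.take (k + 1) = h.take k ++ [h[k]'(by omega)] :=
    List.take_succ_eq_append_getElem (by omega)
  have hnotMem : h[k]'(by omega) ∉ h.take k := by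
    have := hnd.sublist (List.take_sublist (k + 1) h)
    rw [hck'] at this
    exact fun hm => (List.nodup_append.mp this).2.2 _ hm _ (by simp) rfl
  generalize hc : h[k - 1]'(by omega) = c at *
  generalize hd : h[k]'(by omega) = d at *
  have hsh' := hsh
  obtain ⟨hhead, hchain⟩ := (isHistory_iff_isChain E C _ _).mp hsh'
  obtain ⟨tl, rfl⟩ := List.head?_eq_some_iff.mp hhead
  by_cases hnext : tl.head? = some d
  · refine Or.inr ⟨?_, fun hg => hg.2.2.2.2 d hnext rfl⟩
    obtain ⟨r, rfl⟩ := List.head?_eq_some_iff.mp hnext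
    have havoid : ∀ x ∈ h.take k, x ∉ d :: r := by
      intro x hx
      rw [hck, List.mem_append, List.mem_singleton] at hx
      rcases hx with hx | rfl
      · exact fun hm => hs2 x hx (List.mem_cons_of_mem _ hm)
      · exact hs1
    obtain ⟨ls, t, hls, hdt, ht, hsub, heq, hlast⟩ :=
      exists_loop_decomposition _ d r hchain.of_cons
    refine ⟨(ls, d :: t), ⟨?_, ?_, ?_, ?_, ?_⟩, ?_⟩
    · intro l hl
      obtain ⟨⟨w, rfl, hw⟩, hlc, hlsub⟩ := hls l hl
      exact ⟨(isHistory_iff_isChain E C _ _).mpr ⟨rfl, hlc⟩, by simp,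
        by simp [List.getLast?_cons], by simpa using hw, fun x hx hm => havoid x hx (hlsub hm)⟩
    · exact (isHistory_iff_isChain E C _ _).mpr ⟨rfl, ht⟩
    · obtain ⟨e, he, hgoal⟩ := hsg
      exact ⟨e, by rw [← hlast, ← he, List.getLast?_cons_cons], hgoal⟩
    · intro x hx
      rw [hck', List.mem_append, List.mem_singleton] at hx
      rcases hx with hx | rfl
      · exact fun hm => havoid x hx (List.mem_cons_of_mem _ (hsub hm))
      · exact hdt
    · simp [hcat, hcatAll_eq_append_flatMap, ← heq]
    · rintro ⟨ls', g⟩ ⟨hls', hg, -, hgavoid, heq'⟩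
      obtain ⟨t', rfl⟩ := List.head?_eq_some_iff.mp hg.1
      have hdt' : d ∉ t' := hgavoid d (by simp [hck'])
      simp only [hcat, hcatAll_eq_append_flatMap, List.cons_append, List.nil_append,
        List.tail_cons, List.cons.injEq, true_and] at heq'
      obtain ⟨rfl, rfl⟩ := loop_decomposition_unique (fun l hl => (hls' l hl).isLoopAt)
        (fun l hl => (hls l hl).1) hdt' hdt (heq'.symm.trans heq)
      rfl
  · refine Or.inl ⟨⟨hsh, hsg, hs1, hs2, fun x hx hxd => hnext (hxd ▸ hx)⟩, ?_⟩
    rintro ⟨⟨ls, g⟩, ⟨-, -, -, -, heq⟩, -⟩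
    apply hnext
    simp only [hcat, hcatAll_eq_append_flatMap, List.cons_append, List.cons.injEq,
      true_and] at heq
    simp [heq]
end
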